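/- arXiv:2503.06300 — 4 statements merged into one kernel-verified Lean document; each statement's English description precedes it below -/
import Mathlib

section
/- Let E be a real inner product space, let n ∈ E be a unit vector, let μ > 0 be a real number, let λ ∈ E, and let v_t ∈ E satisfy ⟨n, v_t⟩ = 0. Write λ_n := ⟨n, λ⟩ and λ_t := λ − λ_n • n, and let C_n := {x ∈ E : ‖x − ⟨n, x⟩ • n‖ ≤ ⟨n, x⟩} be the second-order cone with axis n. Then the following are equivalent: (i) there exists β ∈ ℝ such that (μ λ_n) • n + λ_t ∈ C_n, β • n + v_t ∈ C_n, and ⟨(μ λ_n) • n + λ_t, β • n + v_t⟩ = 0; (ii) μ λ_n − ‖λ_t‖ ≥ 0, ‖v_t‖ · (μ λ_n − ‖λ_t‖) = 0, and ‖v_t‖ • λ_t + (μ λ_n) • v_t = 0. -/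
open scoped RealInnerProductSpace

/-- Membership in the second-order cone with axis `n` for a vector split into a normal
component `a • n` and a component `t` orthogonal to `n`. -/
theorem norm_sub_inner_smul_le_inner_iff {E : Type*} [NormedAddCommGroup E]
    [InnerProductSpace ℝ E] {n t : E} (hn : ‖n‖ = 1) (ht : ⟪n, t⟫ = 0) (a : ℝ) :
    ‖a • n + t - ⟪n, a • n + t⟫ • n‖ ≤ ⟪n, a • n + t⟫ ↔ ‖t‖ ≤ a := by
  have h : ⟪n, a • n + t⟫ = a := by
    simp [inner_add_right, inner_smul_right, hn, ht]
  rw [h, add_sub_cancel_left]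

/-- The inner product of two vectors split along a unit vector `n`. -/
theorem inner_smul_add_smul_add {E : Type*} [NormedAddCommGroup E]
    [InnerProductSpace ℝ E] {n t v : E} (hn : ‖n‖ = 1) (ht : ⟪n, t⟫ = 0) (hv : ⟪n, v⟫ = 0)
    (a b : ℝ) : ⟪a • n + t, b • n + v⟫ = a * b + ⟪t, v⟫ := by
  have ht' : ⟪t, n⟫ = 0 := by rw [real_inner_comm, ht]
  simp [inner_add_left, inner_add_right, inner_smul_left, inner_smul_right, hn, ht', hv, mul_comm]

/-- Complementarity of two vectors of the second-order cone, in terms of their components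
orthogonal to the axis. -/
theorem exists_norm_le_and_mul_add_inner_eq_zero_iff {E : Type*} [NormedAddCommGroup E]
    [InnerProductSpace ℝ E] (a : ℝ) (t v : E) :
    (∃ b : ℝ, ‖t‖ ≤ a ∧ ‖v‖ ≤ b ∧ a * b + ⟪t, v⟫ = 0) ↔
      (0 ≤ a - ‖t‖ ∧ ‖v‖ * (a - ‖t‖) = 0 ∧ ‖v‖ • t + a • v = 0) := by
  constructor
  · rintro ⟨b, hta, hvb, h⟩
    have hcs : -⟪t, v⟫ ≤ ‖t‖ * ‖v‖ := (neg_le_abs _).trans (abs_real_inner_le_norm t v)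
    have h₁ : ‖t‖ * ‖v‖ ≤ a * ‖v‖ := mul_le_mul_of_nonneg_right hta (norm_nonneg v)
    have h₂ : a * ‖v‖ ≤ a * b := mul_le_mul_of_nonneg_left hvb ((norm_nonneg t).trans hta)
    have heq : ‖t‖ * ‖v‖ = a * ‖v‖ := by linarith
    have hin : ⟪t, v⟫ = -(a * ‖v‖) := by linarith
    refine ⟨sub_nonneg.2 hta, by linarith, ?_⟩
    rw [← norm_eq_zero, ← sq_eq_zero_iff, norm_add_sq_real, norm_smul, norm_smul,
      inner_smul_left, inner_smul_right, hin, norm_norm, Real.norm_eq_abs, mul_pow, mul_pow,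
      sq_abs, RCLike.conj_to_real]
    linear_combination (‖t‖ * ‖v‖ + a * ‖v‖) * heq
  · rintro ⟨hta, -, h⟩
    refine ⟨‖v‖, sub_nonneg.1 hta, le_rfl, ?_⟩
    rcases eq_or_ne v 0 with rfl | hv
    · simp
    · have h' : ⟪‖v‖ • t + a • v, v⟫ = 0 := by rw [h, inner_zero_left]
      rw [inner_add_left, real_inner_smul_left, real_inner_smul_left,
        real_inner_self_eq_norm_sq] at h'
      refine mul_left_cancel₀ (norm_ne_zero_iff.2 hv) ?_
      linear_combination h'

/-- Proposition 1: the conic complementarity form of the Coulomb friction law is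
equivalent to the KKT conditions of the principle of maximal dissipation. -/
theorem coulomb_cone_iff_kkt {E : Type*} [NormedAddCommGroup E] [InnerProductSpace ℝ E]
    (n : E) (hn : ‖n‖ = 1) (μ : ℝ) (hμ : 0 < μ) (lam vt : E)
    (hvt : ⟪n, vt⟫ = 0)
    (lamn : ℝ) (hlamn : lamn = ⟪n, lam⟫)
    (lamt : E) (hlamt : lamt = lam - lamn • n)
    (Cn : Set E) (hCn : Cn = {x : E | ‖x - ⟪n, x⟫ • n‖ ≤ ⟪n, x⟫}) :
    (∃ β : ℝ, (μ * lamn) • n + lamt ∈ Cn ∧ β • n + vt ∈ Cn ∧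
        ⟪(μ * lamn) • n + lamt, β • n + vt⟫ = 0) ↔
      (0 ≤ μ * lamn - ‖lamt‖ ∧ ‖vt‖ * (μ * lamn - ‖lamt‖) = 0 ∧
        ‖vt‖ • lamt + (μ * lamn) • vt = 0) := by
  have ht : ⟪n, lamt⟫ = 0 := by
    simp [hlamt, hlamn, inner_sub_right, inner_smul_right, hn]
  simp only [hCn, Set.mem_ofPred_eq, norm_sub_inner_smul_le_inner_iff hn ht,
    norm_sub_inner_smul_le_inner_iff hn hvt, inner_smul_add_smul_add hn ht hvt]
  exact exists_norm_le_and_mul_add_inner_eq_zero_iff _ _ _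
end

section
/- Let E be a real inner product space, let n ∈ E be a unit vector, let μ > 0, let λ ∈ E with λ_n := ⟨n, λ⟩ and λ_t := λ − λ_n • n, and let v_t ∈ E with ⟨n, v_t⟩ = 0. Let C_n := {x ∈ E : ‖x − ⟨n, x⟩ • n‖ ≤ ⟨n, x⟩}. If μ λ_n > ‖λ_t‖ (stick condition) and there exists β ∈ ℝ such that β • n + v_t ∈ C_n and ⟨(μ λ_n) • n + λ_t, β • n + v_t⟩ = 0, then β = 0 and v_t = 0. -/
open scoped RealInnerProductSpace

/-- Stick case of Proposition 1: if the friction force lies strictly inside the friction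
cone, the conic complementarity condition forces the tangential velocity to vanish. -/
theorem coulomb_stick_case {E : Type*} [NormedAddCommGroup E] [InnerProductSpace ℝ E]
    (n : E) (hn : ‖n‖ = 1) (μ : ℝ) (hμ : 0 < μ) (lam vt : E)
    (hvt : ⟪n, vt⟫ = 0)
    (lamn : ℝ) (hlamn : lamn = ⟪n, lam⟫)
    (lamt : E) (hlamt : lamt = lam - lamn • n)
    (Cn : Set E) (hCn : Cn = {x : E | ‖x - ⟪n, x⟫ • n‖ ≤ ⟪n, x⟫})
    (hstick : ‖lamt‖ < μ * lamn)
    (β : ℝ) (hβ : β • n + vt ∈ Cn)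
    (hcomp : ⟪(μ * lamn) • n + lamt, β • n + vt⟫ = 0) :
    β = 0 ∧ vt = 0 := by
  subst hCn
  have hnn : ⟪n, n⟫ = 1 := by rw [real_inner_self_eq_norm_sq, hn, one_pow]
  have hx : ⟪n, β • n + vt⟫ = β := by
    rw [inner_add_right, real_inner_smul_right, hnn, hvt]
    ring
  have hnlamt : ⟪lamt, n⟫ = 0 := by
    rw [real_inner_comm, hlamt, inner_sub_right, real_inner_smul_right, hnn, hlamn]
    ring
  have hvβ : ‖vt‖ ≤ β := by
    rwa [Set.mem_ofPred_eq, hx, add_sub_cancel_left] at hβ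
  have hsum : μ * lamn * β + ⟪lamt, vt⟫ = 0 := by
    rw [inner_add_left, real_inner_smul_left, hx, inner_add_right, real_inner_smul_right,
      hnlamt] at hcomp
    linarith
  have hcs : -(‖lamt‖ * ‖vt‖) ≤ ⟪lamt, vt⟫ :=
    (abs_le.mp (abs_real_inner_le_norm lamt vt)).1
  have hβ_nonneg : 0 ≤ β := (norm_nonneg vt).trans hvβ
  have hβ_zero : β = 0 := by
    have hmul := mul_le_mul_of_nonneg_left hvβ (norm_nonneg lamt)
    nlinarith
  exact ⟨hβ_zero, norm_le_zero_iff.mp (hvβ.trans_eq hβ_zero)⟩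
end

section
/- Let E be a real inner product space, let n ∈ E be a unit vector, let μ > 0, let λ ∈ E with λ_n := ⟨n, λ⟩ and λ_t := λ − λ_n • n, and let v_t ∈ E with ⟨n, v_t⟩ = 0. Let C_n := {x ∈ E : ‖x − ⟨n, x⟩ • n‖ ≤ ⟨n, x⟩}. If μ λ_n = ‖λ_t‖ > 0 (slip condition) and there exists β ∈ ℝ such that β • n + v_t ∈ C_n and ⟨(μ λ_n) • n + λ_t, β • n + v_t⟩ = 0, then β = ‖v_t‖ and ‖v_t‖ • λ_t + (μ λ_n) • v_t = 0. -/
open scoped RealInnerProductSpace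

/-- Slip case of Proposition 1: if the friction force lies on the boundary of the
friction cone, the complementary element also lies on the boundary of the second-order
cone and the tangential force is antiparallel to the tangential velocity. -/
theorem coulomb_slip_case {E : Type*} [NormedAddCommGroup E] [InnerProductSpace ℝ E]
    (n : E) (hn : ‖n‖ = 1) (μ : ℝ) (hμ : 0 < μ) (lam vt : E)
    (hvt : ⟪n, vt⟫ = 0)
    (lamn : ℝ) (hlamn : lamn = ⟪n, lam⟫)
    (lamt : E) (hlamt : lamt = lam - lamn • n)
    (Cn : Set E) (hCn : Cn = {x : E | ‖x - ⟪n, x⟫ • n‖ ≤ ⟪n, x⟫})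
    (hslip : μ * lamn = ‖lamt‖) (hpos : 0 < ‖lamt‖)
    (β : ℝ) (hβ : β • n + vt ∈ Cn)
    (hcomp : ⟪(μ * lamn) • n + lamt, β • n + vt⟫ = 0) :
    β = ‖vt‖ ∧ ‖vt‖ • lamt + (μ * lamn) • vt = 0 := by
  have hnn : ⟪n, n⟫ = 1 := by rw [real_inner_self_eq_norm_sq, hn, one_pow]
  have hnt : ⟪n, lamt⟫ = 0 := by
    rw [hlamt, inner_sub_right, inner_smul_right, hnn, hlamn]; ring
  have hnx : ⟪n, β • n + vt⟫ = β := by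
    rw [inner_add_right, inner_smul_right, hnn, hvt]; ring
  have hle : ‖vt‖ ≤ β := by
    rw [hCn, Set.mem_ofPred_eq, hnx, add_sub_cancel_left] at hβ
    exact hβ
  have hc : ‖lamt‖ * β + ⟪lamt, vt⟫ = 0 := by
    rw [hslip, inner_add_left, inner_smul_left, hnx, inner_add_right, inner_smul_right,
      real_inner_comm n lamt, hnt] at hcomp
    simpa using hcomp
  have hβ_eq : β = ‖vt‖ := by
    refine le_antisymm (le_of_mul_le_mul_left ?_ hpos) hle
    linarith [neg_le_of_abs_le (abs_real_inner_le_norm lamt vt)]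
  refine ⟨hβ_eq, ?_⟩
  rw [hslip, ← norm_eq_zero, ← sq_eq_zero_iff, norm_add_sq_real, norm_smul, norm_smul,
    inner_smul_left, inner_smul_right, norm_norm, norm_norm, conj_trivial]
  rw [hβ_eq] at hc
  linear_combination 2 * ‖vt‖ * ‖lamt‖ * hc
end

section
/- Let E be a real inner product space, let n ∈ E be a unit vector, and let C_n := {x ∈ E : ‖x − ⟨n, x⟩ • n‖ ≤ ⟨n, x⟩}. Suppose x, y ∈ C_n satisfy ⟨x, y⟩ = 0, x ≠ 0, and y ≠ 0. Writing x_n := ⟨n, x⟩, x_t := x − x_n • n, y_n := ⟨n, y⟩, y_t := y − y_n • n, one has x_n = ‖x_t‖, y_n = ‖y_t‖, and x_n • y_t + y_n • x_t = 0. -/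
open scoped RealInnerProductSpace

/-- If `u` and `v` have norms at most `a` and `b` and `⟪u, v⟫ = -(a * b)`, then both norm bounds
are attained and `a • v` is opposite to `b • u`. -/
theorem norm_eq_and_smul_add_smul_eq_zero_of_inner_eq_neg_mul {E : Type*} [NormedAddCommGroup E]
    [InnerProductSpace ℝ E] {u v : E} {a b : ℝ} (ha : 0 < a) (hb : 0 < b)
    (hu : ‖u‖ ≤ a) (hv : ‖v‖ ≤ b) (huv : ⟪u, v⟫ = -(a * b)) :
    a = ‖u‖ ∧ b = ‖v‖ ∧ a • v + b • u = 0 := by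
  have hcs : a * b ≤ ‖u‖ * ‖v‖ := by
    have h := abs_real_inner_le_norm u v
    rwa [huv, abs_neg, abs_of_pos (mul_pos ha hb)] at h
  have hua : a = ‖u‖ := by
    refine le_antisymm (le_of_mul_le_mul_right ?_ hb) hu
    exact hcs.trans (mul_le_mul_of_nonneg_left hv (norm_nonneg u))
  have hvb : b = ‖v‖ := by
    refine le_antisymm (le_of_mul_le_mul_left ?_ ha) hv
    exact hcs.trans (mul_le_mul_of_nonneg_right hu (norm_nonneg v))
  refine ⟨hua, hvb, ?_⟩
  rw [← norm_eq_zero, ← sq_eq_zero_iff, norm_add_sq_real, norm_smul, norm_smul,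
    real_inner_smul_left, real_inner_smul_right, real_inner_comm, huv, ← hua, ← hvb,
    Real.norm_of_nonneg ha.le, Real.norm_of_nonneg hb.le]
  ring

/-- A nonzero element of a second-order cone has positive normal component. -/
theorem inner_pos_of_norm_sub_inner_smul_le {E : Type*} [NormedAddCommGroup E]
    [InnerProductSpace ℝ E] {n x : E} (hx : ‖x - ⟪n, x⟫ • n‖ ≤ ⟪n, x⟫) (hx0 : x ≠ 0) :
    0 < ⟪n, x⟫ := by
  refine lt_of_le_of_ne ((norm_nonneg _).trans hx) fun h => hx0 ?_
  simpa [← h] using hx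

/-- Two nonzero orthogonal elements of the second-order cone both lie on its boundary
and have antiparallel tangential components. -/
theorem secondOrderCone_orth_boundary {E : Type*} [NormedAddCommGroup E]
    [InnerProductSpace ℝ E] (n : E) (hn : ‖n‖ = 1)
    (Cn : Set E) (hCn : Cn = {x : E | ‖x - ⟪n, x⟫ • n‖ ≤ ⟪n, x⟫})
    (x y : E) (hx : x ∈ Cn) (hy : y ∈ Cn) (hxy : ⟪x, y⟫ = 0)
    (hx0 : x ≠ 0) (hy0 : y ≠ 0) :
    ⟪n, x⟫ = ‖x - ⟪n, x⟫ • n‖ ∧ ⟪n, y⟫ = ‖y - ⟪n, y⟫ • n‖ ∧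
      ⟪n, x⟫ • (y - ⟪n, y⟫ • n) + ⟪n, y⟫ • (x - ⟪n, x⟫ • n) = 0 := by
  subst hCn
  refine norm_eq_and_smul_add_smul_eq_zero_of_inner_eq_neg_mul
    (inner_pos_of_norm_sub_inner_smul_le hx hx0) (inner_pos_of_norm_sub_inner_smul_le hy hy0)
    hx hy ?_
  simp only [inner_sub_left, inner_sub_right, real_inner_smul_left, real_inner_smul_right,
    real_inner_self_eq_norm_sq, hn, hxy, real_inner_comm n x]
  ring
end
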